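/- For every 1 ≤ k ≤ n, the left descent set of τ_k^{−k} is des(τ_k^{−k}) = {0, 1, 2, …, k−1}; that is, for every 0 ≤ j ≤ k−1 one has ℓ(s_j·τ_k^{−k}) < ℓ(τ_k^{−k}), and for every k ≤ j ≤ n−1 one has ℓ(s_j·τ_k^{−k}) > ℓ(τ_k^{−k}). -/

import Mathlib

/-- The Coxeter matrix of type `Bₙ`, with the bond of order `4` between the
generators of indices `0` and `1` (the paper's convention): `s_i² = 1`,
`(s_0·s_1)⁴ = 1`, `(s_i·s_{i+1})³ = 1` for `1 ≤ i ≤ n-2`, and `(s_i·s_j)² = 1`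
for `|i-j| ≥ 2`. -/
def BCoxeterMatrix (n : ℕ) : CoxeterMatrix (Fin n) where
  M := Matrix.of fun i j : Fin n ↦
    if i = j then 1
      else if ((i : ℕ) = 0 ∧ (j : ℕ) = 1) ∨ ((j : ℕ) = 0 ∧ (i : ℕ) = 1) then 4
      else if (j : ℕ) + 1 = i ∨ (i : ℕ) + 1 = j then 3 else 2
  isSymm := by unfold Matrix.IsSymm; aesop
  diagonal := by simp
  off_diagonal := by aesop

variable {n : ℕ} {W : Type*} [Group W]

/-- The simple reflection `s_j` of the Coxeter system, for `0 ≤ j ≤ n-1`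
(junk value `1` for `j ≥ n`). -/
def sgen (cs : CoxeterSystem (BCoxeterMatrix n) W) (j : ℕ) : W :=
  if h : j < n then cs.simple ⟨j, h⟩ else 1

/-- `tau cs k` is the element `τ_k = s_0 · s_1 ⋯ s_{k-1}` (with `τ_0 = 1`). -/
def tau (cs : CoxeterSystem (BCoxeterMatrix n) W) (k : ℕ) : W :=
  ((List.range k).map (sgen cs)).prod

namespace BCoxeter

/-! ### Relations between the generators -/

section Relations

variable (cs : CoxeterSystem (BCoxeterMatrix n) W)

lemma sgen_of_lt {j : ℕ} (h : j < n) : sgen cs j = cs.simple ⟨j, h⟩ := dif_pos h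

lemma sgen_mul_self (j : ℕ) : sgen cs j * sgen cs j = 1 := by
  unfold sgen
  split_ifs <;> simp

lemma length_sgen_le (j : ℕ) : cs.length (sgen cs j) ≤ 1 := by
  unfold sgen
  split_ifs <;> simp

lemma sgen_commute {i j : ℕ} (h : i + 2 ≤ j) : sgen cs i * sgen cs j = sgen cs j * sgen cs i := by
  unfold sgen
  split_ifs with hi hj
  · have key := cs.simple_mul_simple_pow ⟨i, hi⟩ ⟨j, hj⟩
    have hM : (BCoxeterMatrix n) ⟨i, hi⟩ ⟨j, hj⟩ = 2 := by
      simp only [BCoxeterMatrix, Matrix.of_apply, Fin.mk.injEq]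
      grind
    rw [hM, pow_two, ← eq_inv_iff_mul_eq_one] at key
    simpa using key
  all_goals simp

lemma sgen_braid {i : ℕ} (hi : 1 ≤ i) (hn : i + 1 < n) :
    sgen cs i * sgen cs (i + 1) * sgen cs i =
      sgen cs (i + 1) * sgen cs i * sgen cs (i + 1) := by
  rw [sgen_of_lt cs hn, sgen_of_lt cs (Nat.lt_of_succ_lt hn)]
  have key := cs.simple_mul_simple_pow ⟨i, Nat.lt_of_succ_lt hn⟩ ⟨i + 1, hn⟩
  have hM : (BCoxeterMatrix n) ⟨i, Nat.lt_of_succ_lt hn⟩ ⟨i + 1, hn⟩ = 3 := by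
    simp only [BCoxeterMatrix, Matrix.of_apply, Fin.mk.injEq]
    grind
  rw [hM, pow_succ, pow_two] at key
  rw [← mul_inv_eq_one, ← key]
  simp [mul_assoc]

lemma sgen_braid_zero_one (hn : 1 < n) :
    sgen cs 0 * sgen cs 1 * sgen cs 0 * sgen cs 1 =
      sgen cs 1 * sgen cs 0 * sgen cs 1 * sgen cs 0 := by
  rw [sgen_of_lt cs hn, sgen_of_lt cs (Nat.zero_lt_of_lt hn)]
  have key := cs.simple_mul_simple_pow ⟨0, Nat.zero_lt_of_lt hn⟩ ⟨1, hn⟩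
  have hM : (BCoxeterMatrix n) ⟨0, Nat.zero_lt_of_lt hn⟩ ⟨1, hn⟩ = 4 := by
    simp [BCoxeterMatrix]
  rw [hM, pow_succ, pow_succ, pow_two] at key
  rw [← mul_inv_eq_one, ← key]
  simp [mul_assoc]

@[simp] lemma tau_zero : tau cs 0 = 1 := by simp [tau]

lemma tau_succ (k : ℕ) : tau cs (k + 1) = tau cs k * sgen cs k := by
  simp [tau, List.range_succ]

lemma sgen_mul_tau {j k : ℕ} (h : k < j) : sgen cs j * tau cs k = tau cs k * sgen cs j := by
  induction k with
  | zero => simp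
  | succ k ih =>
    rw [tau_succ, ← mul_assoc, ih (by omega), mul_assoc, mul_assoc, sgen_commute cs (i := k) h]

lemma tau_mul_sgen {i k : ℕ} (hi : 1 ≤ i) (hik : i + 1 < k) (hkn : k ≤ n) :
    tau cs k * sgen cs i = sgen cs (i + 1) * tau cs k := by
  induction k, hik using Nat.le_induction with
  | base =>
    have hb := sgen_braid cs hi hkn
    have hc := sgen_mul_tau cs (Nat.lt_succ_self i)
    rw [Nat.succ_eq_add_one, tau_succ, tau_succ, mul_assoc, mul_assoc, ← mul_assoc (sgen cs i), hb]
    simp only [← mul_assoc, hc]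
  | succ k hk ih =>
    rw [tau_succ, mul_assoc, ← sgen_commute cs (by omega), ← mul_assoc, ih (by omega), mul_assoc]

lemma tau_mul_sgen_zero {k : ℕ} (hk : 2 ≤ k) (hkn : k ≤ n) :
    tau cs k * sgen cs 0 = sgen cs 1 * sgen cs 0 * sgen cs 1 * tau cs k := by
  induction k, hk using Nat.le_induction with
  | base =>
    have hb := sgen_braid_zero_one cs (by omega)
    have h1 := sgen_mul_self cs 1
    simp only [tau_succ, tau_zero, one_mul, ← mul_assoc]
    rw [← hb, mul_assoc _ (sgen cs 1) (sgen cs 1), h1, mul_one]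
  | succ k hk ih =>
    rw [tau_succ, mul_assoc, ← sgen_commute cs (by omega), ← mul_assoc, ih (by omega), mul_assoc]

lemma tau_pow_mul_sgen {i k : ℕ} (hi : 1 ≤ i) (hkn : k ≤ n) (m : ℕ) (hm : i + m < k) :
    tau cs k ^ m * sgen cs i = sgen cs (i + m) * tau cs k ^ m := by
  induction m with
  | zero => simp
  | succ m ih =>
    rw [pow_succ', mul_assoc, ih (by omega), ← mul_assoc, tau_mul_sgen cs (by omega) (by omega) hkn,
      mul_assoc, add_assoc]

/-- The reflection `s_m ⋯ s_1 · s_0 · s_1 ⋯ s_m`. -/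
def signRefl : ℕ → W
  | 0 => sgen cs 0
  | m + 1 => sgen cs (m + 1) * signRefl m * sgen cs (m + 1)

lemma tau_mul_signRefl {k : ℕ} (hkn : k ≤ n) (m : ℕ) (hm : m + 1 < k) :
    tau cs k * signRefl cs m = signRefl cs (m + 1) * tau cs k := by
  induction m with
  | zero => exact tau_mul_sgen_zero cs (by omega) hkn
  | succ m ih =>
    have h := tau_mul_sgen cs (i := m + 1) (by omega) hm hkn
    rw [signRefl, ← mul_assoc, ← mul_assoc, h, mul_assoc (sgen cs _) (tau cs k),
      ih (by omega), mul_assoc, mul_assoc, h]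
    simp only [signRefl, mul_assoc]

lemma tau_succ_mul_signRefl (m : ℕ) :
    tau cs (m + 1) * signRefl cs m = sgen cs 0 * tau cs (m + 1) := by
  induction m with
  | zero => simp [tau_succ, signRefl]
  | succ m ih =>
    have h := sgen_mul_self cs (m + 1)
    rw [tau_succ cs (m + 1), signRefl, mul_assoc, mul_assoc (sgen cs (m + 1)),
      ← mul_assoc (sgen cs (m + 1)) (sgen cs (m + 1)), h, one_mul, ← mul_assoc, ih, mul_assoc]

lemma tau_pow_mul_sgen_zero {k : ℕ} (hkn : k ≤ n) (m : ℕ) (hm : m < k) :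
    tau cs k ^ m * sgen cs 0 = signRefl cs m * tau cs k ^ m := by
  induction m with
  | zero => simp [signRefl]
  | succ m ih =>
    rw [pow_succ', mul_assoc, ih (by omega), ← mul_assoc, tau_mul_signRefl cs hkn m hm, mul_assoc]

lemma tau_pow_self_mul_sgen_zero {k : ℕ} (hk : 1 ≤ k) (hkn : k ≤ n) :
    tau cs k ^ k * sgen cs 0 = sgen cs 0 * tau cs k ^ k := by
  obtain ⟨m, rfl⟩ := Nat.exists_eq_add_of_le' hk
  rw [pow_succ', mul_assoc, tau_pow_mul_sgen_zero cs hkn m (by omega), ← mul_assoc,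
    tau_succ_mul_signRefl, mul_assoc]

end Relations

/-! ### Upper bounds on the length -/

section UpperBounds

variable (cs : CoxeterSystem (BCoxeterMatrix n) W)

lemma length_pow_le (w : W) (m : ℕ) : cs.length (w ^ m) ≤ m * cs.length w := by
  induction m with
  | zero => simp
  | succ m ih =>
    rw [pow_succ]
    linarith [cs.length_mul_le (w ^ m) w]

lemma length_tau_le (k : ℕ) : cs.length (tau cs k) ≤ k := by
  induction k with
  | zero => simp
  | succ k ih =>
    rw [tau_succ]
    linarith [cs.length_mul_le (tau cs k) (sgen cs k), length_sgen_le cs k]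

lemma length_tau_pow_le (k m : ℕ) : cs.length (tau cs k ^ m) ≤ m * k :=
  (length_pow_le cs _ m).trans (Nat.mul_le_mul_left m (length_tau_le cs k))

lemma length_sgen_zero_mul_tau_succ_le (k : ℕ) :
    cs.length (sgen cs 0 * tau cs (k + 1)) ≤ k := by
  induction k with
  | zero => simp [tau_succ, sgen_mul_self]
  | succ k ih =>
    rw [tau_succ, ← mul_assoc]
    linarith [cs.length_mul_le (sgen cs 0 * tau cs (k + 1)) (sgen cs (k + 1)),
      length_sgen_le cs (k + 1)]

lemma length_tau_pow_mul_sgen_lt {j k : ℕ} (hj : j < k) (hkn : k ≤ n) :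
    cs.length (tau cs k ^ k * sgen cs j) < k * k := by
  obtain ⟨m, rfl⟩ := Nat.exists_eq_add_of_lt hj
  rcases Nat.eq_zero_or_pos j with rfl | hj0
  · rw [tau_pow_self_mul_sgen_zero cs (by omega) hkn, pow_succ', ← mul_assoc]
    have h1 := length_sgen_zero_mul_tau_succ_le cs (0 + m)
    have h2 := length_tau_pow_le cs (0 + m + 1) (0 + m)
    have h3 := cs.length_mul_le (sgen cs 0 * tau cs (0 + m + 1)) (tau cs (0 + m + 1) ^ (0 + m))
    nlinarith
  · have h : tau cs (j + m + 1) ^ (j + m + 1) * sgen cs j =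
        tau cs (j + m + 1) ^ j * (tau cs (j + m) * tau cs (j + m + 1) ^ m) := by
      rw [show j + m + 1 = j + 1 + m by ring, pow_add, mul_assoc,
        tau_pow_mul_sgen cs hj0 (by omega) m (by omega), pow_succ, mul_assoc, ← mul_assoc (tau _ _),
        show j + 1 + m = j + m + 1 by ring, tau_succ cs (j + m), mul_assoc (tau cs (j + m)),
        sgen_mul_self, mul_one]
    rw [h]
    have h1 := length_tau_pow_le cs (j + m + 1) j
    have h2 := length_tau_pow_le cs (j + m + 1) m
    have h3 := length_tau_le cs (j + m)
    have h4 := cs.length_mul_le (tau cs (j + m + 1) ^ j)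
      (tau cs (j + m) * tau cs (j + m + 1) ^ m)
    have h5 := cs.length_mul_le (tau cs (j + m)) (tau cs (j + m + 1) ^ m)
    nlinarith

end UpperBounds

/-! ### The action by signed permutations -/

section SignedPermutations

/-- The signed permutation of `ℤ` attached to the `i`-th generator: the sign change at `1` for
`i = 0`, and the exchange of `i` and `i + 1` for `i ≥ 1`. -/
def signedSwap (i : ℕ) : Function.End ℤ := fun x ↦
  if i = 0 then (if x = 1 then -1 else if x = -1 then 1 else x)
  else if x = i then i + 1
  else if x = i + 1 then i
  else if x = -i then -(i + 1)
  else if x = -(i + 1) then -i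
  else x

lemma signedSwap_signedSwap (i : ℕ) (x : ℤ) : signedSwap i (signedSwap i x) = x := by
  unfold signedSwap
  grind

lemma signedSwap_neg (i : ℕ) (x : ℤ) : signedSwap i (-x) = -signedSwap i x := by
  unfold signedSwap
  grind

lemma signedSwap_comm {i j : ℕ} (h : i + 2 ≤ j) (x : ℤ) :
    signedSwap i (signedSwap j x) = signedSwap j (signedSwap i x) := by
  unfold signedSwap
  grind (splits := 25)

lemma signedSwap_braid {i : ℕ} (hi : 1 ≤ i) (x : ℤ) :
    signedSwap i (signedSwap (i + 1) (signedSwap i x)) =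
      signedSwap (i + 1) (signedSwap i (signedSwap (i + 1) x)) := by
  unfold signedSwap
  grind (splits := 25)

lemma signedSwap_braid_zero_one (x : ℤ) :
    signedSwap 0 (signedSwap 1 (signedSwap 0 (signedSwap 1 x))) =
      signedSwap 1 (signedSwap 0 (signedSwap 1 (signedSwap 0 x))) := by
  unfold signedSwap
  grind

lemma isLiftable_signedSwap (n : ℕ) :
    (BCoxeterMatrix n).IsLiftable (fun i : Fin n ↦ signedSwap i) := by
  intro i j
  funext x
  by_cases hij : i = j
  · subst hij
    rw [CoxeterMatrix.diagonal, pow_one]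
    exact signedSwap_signedSwap i x
  have hij' : (i : ℕ) ≠ j := Fin.val_injective.ne hij
  by_cases h4 : ((i : ℕ) = 0 ∧ (j : ℕ) = 1) ∨ ((j : ℕ) = 0 ∧ (i : ℕ) = 1)
  · have hM : (BCoxeterMatrix n) i j = 4 := by
      simp [BCoxeterMatrix, hij, h4]
    rw [hM]
    change signedSwap i (signedSwap j (signedSwap i (signedSwap j
      (signedSwap i (signedSwap j (signedSwap i (signedSwap j x))))))) = x
    obtain ⟨hi, hj⟩ | ⟨hj, hi⟩ := h4
    · rw [hi, hj, signedSwap_braid_zero_one]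
      simp only [signedSwap_signedSwap]
    · rw [hi, hj, ← signedSwap_braid_zero_one]
      simp only [signedSwap_signedSwap]
  by_cases h3 : (j : ℕ) + 1 = i ∨ (i : ℕ) + 1 = j
  · have hM : (BCoxeterMatrix n) i j = 3 := by
      simp [BCoxeterMatrix, hij, h4, h3]
    rw [hM]
    change signedSwap i (signedSwap j (signedSwap i (signedSwap j
      (signedSwap i (signedSwap j x))))) = x
    obtain h | h := h3
    · rw [← h, ← signedSwap_braid (by omega)]
      simp only [signedSwap_signedSwap]
    · rw [← h, signedSwap_braid (by omega)]
      simp only [signedSwap_signedSwap]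
  · have hM : (BCoxeterMatrix n) i j = 2 := by
      simp [BCoxeterMatrix, hij, h4, h3]
    rw [hM]
    change signedSwap i (signedSwap j (signedSwap i (signedSwap j x))) = x
    rcases lt_or_gt_of_ne hij' with h | h
    · rw [signedSwap_comm (by omega)]
      simp only [signedSwap_signedSwap]
    · rw [← signedSwap_comm (by omega)]
      simp only [signedSwap_signedSwap]

noncomputable section

/-- The action of a Coxeter group of type `B` on `ℤ` by signed permutations. -/
def signedAction (cs : CoxeterSystem (BCoxeterMatrix n) W) : W →* Function.End ℤ :=
  cs.lift ⟨_, isLiftable_signedSwap n⟩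

variable (cs : CoxeterSystem (BCoxeterMatrix n) W)

lemma signedAction_simple (i : Fin n) : signedAction cs (cs.simple i) = signedSwap i :=
  cs.lift_apply_simple (isLiftable_signedSwap n) i

lemma signedAction_neg (w : W) (x : ℤ) : signedAction cs w (-x) = -signedAction cs w x := by
  induction w using cs.simple_induction_left generalizing x with
  | one => rw [map_one]; rfl
  | mul_simple_left w i ih =>
    rw [map_mul, signedAction_simple]
    change signedSwap i (signedAction cs w (-x)) = -signedSwap i (signedAction cs w x)
    rw [ih, signedSwap_neg]

/-- The inversions of a signed permutation. The pair `(a, b)` with `|a| < b` stands for the positive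
root `e_b - e_a`, where `e_{-a} = -e_a`. -/
def inversions (n : ℕ) (f : Function.End ℤ) : Finset (ℤ × ℤ) :=
  (Finset.Icc (-n : ℤ) n ×ˢ Finset.Icc 1 (n : ℤ)).filter fun p ↦ |p.1| < p.2 ∧ f p.2 < f p.1

lemma mem_inversions {f : Function.End ℤ} {a b : ℤ} :
    (a, b) ∈ inversions n f ↔ -b < a ∧ a < b ∧ b ≤ n ∧ f b < f a := by
  simp only [inversions, Finset.mem_filter, Finset.mem_product, Finset.mem_Icc, abs_lt]
  constructor <;> intro h <;> grind

lemma signedSwap_lt_signedSwap {i : ℕ} {a b : ℤ} (hab : -b < a) (hba : a < b)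
    (h : ¬(a = i ∧ b = i + 1)) (h' : ¬(a = -i ∧ b = i + 1)) :
    -signedSwap i b < signedSwap i a ∧ signedSwap i a < signedSwap i b := by
  unfold signedSwap
  grind

lemma signedSwap_le {i : ℕ} (hi : i < n) {b : ℤ} (hb : b ≤ n) : signedSwap i b ≤ n := by
  unfold signedSwap
  grind

lemma card_inversions_mul_signedSwap_le {i : ℕ} (hi : i < n) {f : Function.End ℤ}
    (hf : ∀ x, f (-x) = -f x) :
    (inversions n (f * signedSwap i)).card ≤ (inversions n f).card + 1 := by
  have hinj := (show Function.Involutive (signedSwap i) from signedSwap_signedSwap i).injective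
  have hi1 : signedSwap i i = if i = 0 then 0 else (i : ℤ) + 1 := by
    unfold signedSwap; grind
  have hi2 : signedSwap i (i + 1) = if i = 0 then -1 else (i : ℤ) := by
    unfold signedSwap; grind
  refine Nat.sub_le_iff_le_add.mp
    ((Finset.pred_card_le_card_erase (a := ((i : ℤ), (i : ℤ) + 1))).trans ?_)
  let g (p : ℤ × ℤ) : ℤ × ℤ :=
    if p = (-(i : ℤ), (i : ℤ) + 1) then p else (signedSwap i p.1, signedSwap i p.2)
  refine Finset.card_le_card_of_injOn g ?_ ?_
  · rintro ⟨a, b⟩ h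
    simp only [Finset.mem_coe, Finset.mem_erase, mem_inversions, ne_eq, Prod.mk.injEq] at h ⊢
    obtain ⟨hne, hab, hba, hbn, hlt⟩ := h
    change f (signedSwap i b) < f (signedSwap i a) at hlt
    by_cases hs : a = -(i : ℤ) ∧ b = i + 1
    · obtain ⟨rfl, rfl⟩ := hs
      have hg : g (-(i : ℤ), (i : ℤ) + 1) = (-(i : ℤ), (i : ℤ) + 1) := if_pos rfl
      rw [hg, mem_inversions]
      refine ⟨hab, hba, hbn, ?_⟩
      rw [signedSwap_neg, hi1, hi2] at hlt
      have hi0 : i ≠ 0 := by rintro rfl; simp at hne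
      rw [if_neg hi0, if_neg hi0, hf] at hlt
      rw [hf]
      linarith
    · have hg : g (a, b) = (signedSwap i a, signedSwap i b) := if_neg (by simpa using hs)
      rw [hg, mem_inversions]
      have hlt' := signedSwap_lt_signedSwap hab hba hne hs
      exact ⟨hlt'.1, hlt'.2, signedSwap_le hi hbn, hlt⟩
  · rintro ⟨a, b⟩ h ⟨c, d⟩ h' hg
    simp only [Finset.mem_coe, Finset.mem_erase, mem_inversions] at h h'
    have key {x y : ℤ} (hxy : -y < x)
        (he : (signedSwap i x, signedSwap i y) = (-(i : ℤ), (i : ℤ) + 1)) : False := by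
      obtain ⟨hx, hy⟩ := Prod.mk.inj he
      unfold signedSwap at hx hy
      grind
    simp only [g] at hg
    split_ifs at hg with h1 h2 h2
    · exact hg
    · exact (key h'.2.1 (hg.symm.trans h1)).elim
    · exact (key h.2.1 (hg.trans h2)).elim
    · exact Prod.ext (hinj (Prod.mk.inj hg).1) (hinj (Prod.mk.inj hg).2)

lemma card_inversions_le_length (w : W) :
    (inversions n (signedAction cs w)).card ≤ cs.length w := by
  obtain ⟨ω, hω, rfl⟩ := cs.exists_isReduced w
  rw [hω.eq]
  clear hω
  induction ω using List.reverseRecOn with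
  | nil =>
    rw [cs.wordProd_nil, map_one, List.length_nil, Nat.le_zero, Finset.card_eq_zero,
      Finset.eq_empty_iff_forall_notMem]
    rintro ⟨a, b⟩ h
    rw [mem_inversions] at h
    exact lt_asymm h.2.1 h.2.2.2
  | append_singleton ω i ih =>
    rw [cs.wordProd_append, cs.wordProd_singleton, map_mul, signedAction_simple]
    refine (card_inversions_mul_signedSwap_le i.2 (signedAction_neg cs _)).trans ?_
    simpa using ih

lemma le_card_inversions {k : ℕ} (hkn : k ≤ n) {f : Function.End ℤ}
    (hf : ∀ a b : ℤ, -b < a → a < b → b ≤ k → f b < f a) :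
    k * k ≤ (inversions n f).card := by
  have hcard : ((Finset.range k).sigma fun b ↦ Finset.Ioo (-(b + 1 : ℤ)) (b + 1)).card = k * k := by
    rw [Finset.card_sigma]
    clear hf hkn
    induction k with
    | zero => simp
    | succ k ih =>
      rw [Finset.sum_range_succ, ih, Int.card_Ioo]
      have : ((k : ℤ) + 1 - -((k : ℤ) + 1) - 1).toNat = 2 * k + 1 := by omega
      rw [this]
      ring
  rw [← hcard]
  refine Finset.card_le_card_of_injOn (fun p ↦ (p.2, (p.1 : ℤ) + 1)) ?_ ?_
  · rintro ⟨b, a⟩ h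
    simp only [Finset.mem_coe, Finset.mem_sigma, Finset.mem_range, Finset.mem_Ioo] at h
    rw [Finset.mem_coe, mem_inversions]
    dsimp only
    exact ⟨h.2.1, h.2.2, by omega, hf _ _ h.2.1 h.2.2 (by omega)⟩
  · rintro ⟨b, a⟩ - ⟨d, c⟩ - h
    obtain ⟨rfl, h⟩ := Prod.mk.inj h
    obtain rfl : b = d := by simpa using h
    rfl

lemma signedAction_tau {k : ℕ} (hkn : k ≤ n) {x : ℤ} (hx : 1 ≤ x) :
    signedAction cs (tau cs k) x = if x = k then -1 else if x < k then x + 1 else x := by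
  induction k generalizing x with
  | zero =>
    rw [tau_zero, map_one, if_neg (by push_cast; omega), if_neg (by push_cast; omega)]
    rfl
  | succ k ih =>
    rw [tau_succ, sgen_of_lt cs hkn, map_mul, signedAction_simple]
    change signedAction cs (tau cs k) (signedSwap k x) = _
    rcases Nat.eq_zero_or_pos k with rfl | hk
    · rw [tau_zero, map_one]
      change signedSwap 0 x = _
      unfold signedSwap
      grind
    · rw [ih (by omega) (by unfold signedSwap; grind)]
      unfold signedSwap
      grind

lemma signedAction_tau_pow {k : ℕ} (hkn : k ≤ n) (m : ℕ) (hm : m ≤ k) {x : ℤ} (hx : 1 ≤ x)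
    (hxk : x ≤ k) :
    signedAction cs (tau cs k ^ m) x = if x + m ≤ k then x + m else k - (x + m) := by
  induction m with
  | zero =>
    rw [pow_zero, map_one]
    change x = _
    simp [hxk]
  | succ m ih =>
    rw [pow_succ', map_mul]
    change signedAction cs (tau cs k) (signedAction cs (tau cs k ^ m) x) = _
    rw [ih (by omega)]
    by_cases h : x + m ≤ k
    · rw [if_pos h, signedAction_tau cs hkn (by omega)]
      grind
    · rw [if_neg h, ← neg_sub, signedAction_neg, signedAction_tau cs hkn (by omega)]
      grind

lemma signedAction_tau_pow_neg {k : ℕ} (hkn : k ≤ n) {x : ℤ} (hx : -k ≤ x) (hxk : x ≤ k) :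
    signedAction cs (tau cs k ^ (-(k : ℤ))) x = -x := by
  have hpos {y : ℤ} (hy : 1 ≤ y) (hyk : y ≤ k) : signedAction cs (tau cs k ^ k) y = -y := by
    rw [signedAction_tau_pow cs hkn k le_rfl hy hyk]
    grind
  have h : signedAction cs (tau cs k ^ k) (-x) = x := by
    rcases lt_trichotomy x 0 with h | rfl | h
    · rw [hpos (by omega) (by omega), neg_neg]
    · exact self_eq_neg.mp (signedAction_neg cs (tau cs k ^ k) 0)
    · rw [signedAction_neg, hpos (by omega) hxk, neg_neg]
  conv_lhs => rw [← h]
  change (signedAction cs (tau cs k ^ (-(k : ℤ))) * signedAction cs (tau cs k ^ k)) (-x) = -x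
  rw [← map_mul, zpow_neg, zpow_natCast, inv_mul_cancel, map_one]
  rfl

end

end SignedPermutations

end BCoxeter

open BCoxeter

/-- `des(τ_k^{-k}) = {0, 1, …, k-1}`: for `j < k`, `ℓ(s_j·τ_k^{-k}) < ℓ(τ_k^{-k})`,
and for `k ≤ j ≤ n-1`, `ℓ(s_j·τ_k^{-k}) > ℓ(τ_k^{-k})`. -/
theorem descents_tau_pow_neg (cs : CoxeterSystem (BCoxeterMatrix n) W)
    (k : ℕ) (hk : 1 ≤ k) (hkn : k ≤ n) :
    ∀ j : Fin n,
      ((j : ℕ) < k →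
        cs.length (cs.simple j * tau cs k ^ (-(k : ℤ))) <
          cs.length (tau cs k ^ (-(k : ℤ)))) ∧
      (k ≤ (j : ℕ) →
        cs.length (tau cs k ^ (-(k : ℤ))) <
          cs.length (cs.simple j * tau cs k ^ (-(k : ℤ)))) := by
  intro j
  have hle : cs.length (tau cs k ^ (-(k : ℤ))) ≤ k * k := by
    rw [zpow_neg, zpow_natCast, cs.length_inv]
    exact length_tau_pow_le cs k k
  have hge : k * k ≤ cs.length (tau cs k ^ (-(k : ℤ))) := by
    refine (le_card_inversions hkn fun a b hab hba hbk ↦ ?_).trans (card_inversions_le_length cs _)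
    rw [signedAction_tau_pow_neg cs hkn (by omega) hbk,
      signedAction_tau_pow_neg cs hkn (by omega) (by omega)]
    exact neg_lt_neg hba
  constructor
  · intro hj
    refine lt_of_lt_of_le ?_ hge
    have h := length_tau_pow_mul_sgen_lt cs hj hkn
    rwa [sgen_of_lt cs j.2, ← cs.length_inv, mul_inv_rev, cs.inv_simple, ← zpow_natCast,
      ← zpow_neg] at h
  · intro hj
    refine lt_of_le_of_ne (hle.trans ?_) (cs.length_simple_mul_ne _ j).symm
    refine (le_card_inversions hkn fun a b hab hba hbk ↦ ?_).trans (card_inversions_le_length cs _)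
    rw [map_mul, signedAction_simple]
    change signedSwap j (signedAction cs _ b) < signedSwap j (signedAction cs _ a)
    rw [signedAction_tau_pow_neg cs hkn (by omega) hbk,
      signedAction_tau_pow_neg cs hkn (by omega) (by omega)]
    unfold signedSwap
    grind
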